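/- For a logic program Π and a set X of atoms: X ⊆ Head(Π) and X is an input answer set of Π if and only if X is an answer set of Π. -/

import Mathlib

set_option maxHeartbeats 1000000

attribute [local instance] Classical.propDecidable

/-! ## Atoms, literals, clauses -/

/-- Propositional atoms. -/
abbrev Atom : Type := ℕ

/-- Propositional literals: an atom or its negation. -/
inductive Lit where
  | pos : Atom → Lit
  | neg : Atom → Lit
deriving DecidableEq

/-- The atom of a literal. -/
def Lit.atom : Lit → Atom
  | .pos a => a
  | .neg a => a

/-- The complement (dual) of a literal. -/
def Lit.compl : Lit → Lit
  | .pos a => .neg a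
  | .neg a => .pos a

/-- A clause is a set of literals (read disjunctively). -/
abbrev Clause := Set Lit

/-- A CNF formula is a set of clauses. -/
abbrev CNF := Set Clause

/-- Truth of a literal in an interpretation given as the set of true atoms. -/
def litTrue (X : Set Atom) : Lit → Prop
  | .pos a => a ∈ X
  | .neg a => a ∉ X

/-- Truth of a CNF formula in an interpretation. -/
def cnfTrue (X : Set Atom) (F : CNF) : Prop := ∀ C ∈ F, ∃ l ∈ C, litTrue X l

/-- A CNF formula is satisfiable if some interpretation makes it true. -/
def cnfSatisfiable (F : CNF) : Prop := ∃ X : Set Atom, cnfTrue X F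

/-- A set `M` of literals is a model of a CNF formula if every clause contains a literal of `M`. -/
def modelCNF (M : Set Lit) (F : CNF) : Prop := ∀ C ∈ F, ∃ l ∈ C, l ∈ M

/-- A set of literals is consistent if it contains no atom together with its negation. -/
def consistentS (M : Set Lit) : Prop := ∀ a : Atom, ¬ (Lit.pos a ∈ M ∧ Lit.neg a ∈ M)

/-- `M` is complete over a set `A` of atoms: every atom of `A` occurs (possibly negated)
in `M` and no other atoms occur in `M`. -/
def completeOver (M : Set Lit) (A : Set Atom) : Prop :=
  (∀ a ∈ A, Lit.pos a ∈ M ∨ Lit.neg a ∈ M) ∧ ∀ l ∈ M, l.atom ∈ A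

/-- `M⁺`: the atoms occurring non-negated in `M`. -/
def posPart (M : Set Lit) : Set Atom := {a | Lit.pos a ∈ M}

/-- `M^A`: the literals of `M` whose atoms lie in `A`. -/
def restrictLits (M : Set Lit) (A : Set Atom) : Set Lit := {l ∈ M | l.atom ∈ A}

/-- The set of complements of the literals of `M`. -/
def compls (M : Set Lit) : Set Lit := Lit.compl '' M

/-- The atoms occurring in a CNF formula. -/
def atomsCNF (F : CNF) : Set Atom := ⋃ C ∈ F, Lit.atom '' C

/-- A well-formed CNF formula: a finite set of finite non-empty clauses. -/
def IsCNF (F : CNF) : Prop := F.Finite ∧ ∀ C ∈ F, C.Finite ∧ C.Nonempty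

/-! ## Logic programs -/

/-- A rule `a₀ ← a₁,…,a_l, not a_{l+1},…,not a_m, not not a_{m+1},…,not not a_n`.
`head = none` encodes the empty head `⊥` (a constraint). -/
structure Rule where
  head : Option Atom
  bpos : Set Atom
  bneg : Set Atom
  bnneg : Set Atom

/-- The atoms occurring in the body of a rule. -/
def Rule.bodyAtoms (r : Rule) : Set Atom := r.bpos ∪ r.bneg ∪ r.bnneg

/-- The atoms occurring in a rule. -/
def Rule.atoms (r : Rule) : Set Atom :=
  (match r.head with | some a => ({a} : Set Atom) | none => (∅ : Set Atom)) ∪ r.bodyAtoms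

/-- `s(B)` for the body of a rule: `{a₁,…,a_l, ¬a_{l+1},…,¬a_m, a_{m+1},…,a_n}`. -/
def Rule.sBody (r : Rule) : Set Lit :=
  Lit.pos '' r.bpos ∪ Lit.neg '' r.bneg ∪ Lit.pos '' r.bnneg

/-- A (propositional) logic program, as a set of rules. -/
abbrev Program := Set Rule

/-- `Head(Π)`: the set of nonempty heads of rules of `Π`. -/
def headSet (P : Program) : Set Atom := {a | ∃ r ∈ P, r.head = some a}

/-- `At(Π)`: the set of atoms occurring in `Π`. -/
def atomsProg (P : Program) : Set Atom := ⋃ r ∈ P, r.atoms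

/-- A well-formed logic program: finitely many rules, finite bodies, and
constraints have non-empty bodies. -/
def IsProgram (P : Program) : Prop :=
  P.Finite ∧ (∀ r ∈ P, r.bpos.Finite ∧ r.bneg.Finite ∧ r.bnneg.Finite) ∧
    ∀ r ∈ P, r.head = none → r.bodyAtoms.Nonempty

/-- Rule bodies, as triples (positive part, negated part, doubly negated part). -/
abbrev BodyT := Set Atom × Set Atom × Set Atom

/-- The body of a rule. -/
def Rule.body (r : Rule) : BodyT := (r.bpos, r.bneg, r.bnneg)

/-- `s(B)` for a body triple. -/
def sBodyB (B : BodyT) : Set Lit := Lit.pos '' B.1 ∪ Lit.neg '' B.2.1 ∪ Lit.pos '' B.2.2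

/-- `Bodies(Π,a)`: the set of bodies of rules of `Π` with head `a`. -/
def bodiesOf (P : Program) (a : Atom) : Set BodyT := {B | ∃ r ∈ P, r.head = some a ∧ r.body = B}

/-! ## Answer sets -/

/-- A rule survives the reduct with respect to `X`: no `not a` with `a ∈ X`
and no `not not a` with `a ∉ X` occurs in its body. -/
def reductKeeps (r : Rule) (X : Set Atom) : Prop :=
  (∀ a ∈ r.bneg, a ∉ X) ∧ ∀ a ∈ r.bnneg, a ∈ X

/-- `Y` is closed under the positive (non-constraint) rules of the reduct of `P` w.r.t. `X`. -/
def closedUnder (P : Program) (X Y : Set Atom) : Prop :=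
  ∀ r ∈ P, reductKeeps r X → r.bpos ⊆ Y → ∀ a, r.head = some a → a ∈ Y

/-- `X` is an answer set of `P`: `X` is the least model of the positive part of the
reduct `P^X`, and no constraint of the reduct has its body contained in `X`. -/
def isAnswerSet (P : Program) (X : Set Atom) : Prop :=
  X = ⋂₀ {Y | closedUnder P X Y} ∧
    ∀ r ∈ P, r.head = none → reductKeeps r X → ¬ r.bpos ⊆ X

/-- The fact `a ←`. -/
def factRule (a : Atom) : Rule := ⟨some a, ∅, ∅, ∅⟩

/-- The choice rule `a ← not not a`. -/
def choiceRule (a : Atom) : Rule := ⟨some a, ∅, ∅, {a}⟩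

/-- `X` is an input answer set of `P`: `X` is an answer set of `P ∪ (X \ Head(P))`. -/
def inputAnswerSet (P : Program) (X : Set Atom) : Prop :=
  isAnswerSet (P ∪ factRule '' (X \ headSet P)) X

/-- `Π_A`: `Π` extended with the rule `a ← not not a` for each `a ∈ A \ Head(Π)`. -/
def progExt (P : Program) (A : Set Atom) : Program := P ∪ choiceRule '' (A \ headSet P)

/-- `At(F ∪ Π)`: the atoms occurring in `F` and `Π`. -/
def atomsTh (F : CNF) (P : Program) : Set Atom := atomsCNF F ∪ atomsProg P

/-- `Π^o = Π_{At(F∪Π)}` for the pair `[F,Π]`. -/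
def progO (F : CNF) (P : Program) : Program := progExt P (atomsTh F P)

/-- A model of the SM(ASP) theory `[F,Π]`: a consistent set of literals complete over
`At(F∪Π)` that is a model of `F` and whose positive part is an input answer set of `Π`. -/
def smModel (F : CNF) (P : Program) (M : Set Lit) : Prop :=
  consistentS M ∧ completeOver M (atomsTh F P) ∧ modelCNF M F ∧ inputAnswerSet P (posPart M)

/-! ## Unfounded sets and the well-founded operator -/

/-- `U` is unfounded on `M` with respect to `P`. -/
def unfoundedOn (U : Set Atom) (M : Set Lit) (P : Program) : Prop :=
  U ⊆ atomsProg P ∧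
    ∀ a ∈ U, ∀ r ∈ P, r.head = some a →
      (∃ l ∈ r.sBody, l.compl ∈ M) ∨ ∃ b ∈ r.bpos, b ∈ U

/-- The greatest unfounded set on `M` with respect to `P`. -/
def GUS (M : Set Lit) (P : Program) : Set Atom := ⋃₀ {U | unfoundedOn U M P}

/-- The operator `W_P` of the well-founded semantics. -/
noncomputable def WOp (P : Program) (M : Set Lit) : Set Lit :=
  if consistentS M then
    M ∪ Lit.pos '' {a | ∃ r ∈ P, r.head = some a ∧ r.sBody ⊆ M} ∪ Lit.neg '' GUS M P
  else Lit.pos '' atomsProg P ∪ Lit.neg '' atomsProg P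

/-- `W^i_P(M)`: the `i`-fold application of `W_P` to `M`. -/
noncomputable def WIter (P : Program) : ℕ → Set Lit → Set Lit
  | 0, M => M
  | n + 1, M => WOp P (WIter P n M)

/-- `W^fix_P(M)`: the least fixpoint of `W_P` above `M`. -/
def WFix (P : Program) (M : Set Lit) : Set Lit := ⋂₀ {Y | M ⊆ Y ∧ WOp P Y ⊆ Y}

/-! ## PC(ID) -/

/-- A program is weakly normal if every head is an atom. -/
def weaklyNormal (P : Program) : Prop := ∀ r ∈ P, r.head ≠ none

/-- A program is normal if every head is an atom and no double negation occurs. -/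
def normalProg (P : Program) : Prop := ∀ r ∈ P, r.head ≠ none ∧ r.bnneg = ∅

/-- `O^Π = At(F∪Π) \ Head(Π)`: the open atoms of the pair `(F,Π)`. -/
def openAtomsTh (F : CNF) (P : Program) : Set Atom := atomsTh F P \ headSet P

/-- A model of the PC(ID) theory `(F,Π)`. -/
def pcidModel (F : CNF) (P : Program) (M : Set Lit) : Prop :=
  consistentS M ∧ completeOver M (atomsTh F P) ∧ modelCNF M F ∧
    M = WFix (progO F P) (restrictLits M (openAtomsTh F P))

/-- The PC(ID) theory `(F,Π)` is total: `W^fix_{Π^o}(M^{O^Π})` assigns all atoms of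
`At(F∪Π)` for every model `M` of `F`. -/
def pcidTotal (F : CNF) (P : Program) : Prop :=
  ∀ M : Set Lit, consistentS M → completeOver M (atomsTh F P) → modelCNF M F →
    ∀ a ∈ atomsTh F P,
      Lit.pos a ∈ WFix (progO F P) (restrictLits M (openAtomsTh F P)) ∨
      Lit.neg a ∈ WFix (progO F P) (restrictLits M (openAtomsTh F P))

/-! ## Clausal forms and completion -/

/-- The clause corresponding to a rule. -/
def ruleClause (r : Rule) : Clause :=
  (match r.head with | some a => ({Lit.pos a} : Set Lit) | none => (∅ : Set Lit)) ∪
    (Lit.neg '' r.bpos ∪ Lit.pos '' r.bneg ∪ Lit.neg '' r.bnneg)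

/-- `Π^cl`: the clause forms of the rules of `Π`. -/
def progCl (P : Program) : CNF := ruleClause '' P

/-- `a` is a fact in `P`: some rule with head `a` has an empty body. -/
def isFactAtom (P : Program) (a : Atom) : Prop :=
  ∃ r ∈ P, r.head = some a ∧ r.bodyAtoms = ∅

/-- `Comp(Π)`: the clausified completion of `Π`: the clauses `Π^cl` together with all
clauses obtained by distributivity from `¬a ∨ ⋁_{B ∈ Bodies(Π,a)} B`, for every
atom `a` of `Π` that is not a fact. -/
def compClauses (P : Program) : CNF :=
  progCl P ∪
    {C | ∃ a ∈ atomsProg P, ¬ isFactAtom P a ∧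
      ∃ f : BodyT → Lit, (∀ B ∈ bodiesOf P a, f B ∈ sBodyB B) ∧
        C = insert (Lit.neg a) (f '' bodiesOf P a)}

/-- The number of program literals in a body. -/
noncomputable def bodySize (B : BodyT) : ℕ := B.1.ncard + B.2.1.ncard + B.2.2.ncard

/-- `ν` provides the literals `f_B` used by `ED-Comp`: for a singleton body, the
literal `s(l)` of its unique element; for larger bodies, fresh pairwise distinct atoms. -/
def goodNaming (P : Program) (ν : BodyT → Lit) : Prop :=
  (∀ B : BodyT, bodySize B = 1 → ν B ∈ sBodyB B) ∧
  (∀ B : BodyT, 1 < bodySize B → (∃ a : Atom, ν B = Lit.pos a) ∧ (ν B).atom ∉ atomsProg P) ∧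
  ∀ B B' : BodyT, 1 < bodySize B → 1 < bodySize B' → ν B = ν B' → B = B'

/-- `ED-Comp(P)` with respect to the naming `ν`. -/
def EDComp (ν : BodyT → Lit) (P : Program) : CNF :=
  progCl P ∪
  {C | ∃ a ∈ atomsProg P, ¬ isFactAtom P a ∧ ¬ (bodiesOf P a).Subsingleton ∧
        C = insert (Lit.neg a) (ν '' bodiesOf P a)} ∪
  {C | ∃ a ∈ atomsProg P, ∃ B : BodyT, bodiesOf P a = {B} ∧ ∃ l ∈ sBodyB B, C = {Lit.neg a, l}} ∪
  {C | ∃ a ∈ atomsProg P, bodiesOf P a = ∅ ∧ C = {Lit.neg a}} ∪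
  {C | ∃ a ∈ atomsProg P, ¬ isFactAtom P a ∧ ¬ (bodiesOf P a).Subsingleton ∧
        ∃ B ∈ bodiesOf P a, 1 < bodySize B ∧
          ((∃ l ∈ sBodyB B, C = {(ν B).compl, l}) ∨ C = insert (ν B) (compls (sBodyB B)))}

/-! ## PC(ID) theories as programs with constraints -/

/-- `C^r`: the constraint corresponding to a clause `C`. -/
def clauseRule (C : Clause) : Rule := ⟨none, {a | Lit.neg a ∈ C}, {a | Lit.pos a ∈ C}, ∅⟩

/-- `F^r = {C^r : C ∈ F}`. -/
def constraintsOf (F : CNF) : Program := clauseRule '' F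

/-- `π(F,Π) = Π^o ∪ F^r`. -/
def piProg (F : CNF) (P : Program) : Program := progO F P ∪ constraintsOf F

/-! ## Program transformations `ch(N)` and `Π(N)` -/

/-- `ch(N)`: the rules `a ← not not a` for the atoms `a` occurring in `N`. -/
def chProg (N : Set Lit) : Program := choiceRule '' (Lit.atom '' N)

/-- The body of `r` contains a program literal `l` with `s(l)` complement in `N`. -/
def ruleKilled (r : Rule) (N : Set Lit) : Prop :=
  (∃ a ∈ r.bpos, Lit.neg a ∈ N) ∨ (∃ a ∈ r.bneg, Lit.pos a ∈ N) ∨ ∃ a ∈ r.bnneg, Lit.neg a ∈ N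

/-- Delete from the body of `r` every program literal `l` with `s(l) ∈ N`. -/
def ruleReduce (r : Rule) (N : Set Lit) : Rule :=
  ⟨r.head, {a ∈ r.bpos | Lit.pos a ∉ N}, {a ∈ r.bneg | Lit.neg a ∉ N},
    {a ∈ r.bnneg | Lit.pos a ∉ N}⟩

/-- `Π(N)`: remove the rules killed by `N` and reduce the bodies of the remaining rules. -/
def progReduce (P : Program) (N : Set Lit) : Program :=
  (fun r => ruleReduce r N) '' {r ∈ P | ¬ ruleKilled r N}

/-! ## DPLL states and transition graphs -/

/-- A possibly decision-annotated literal. -/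
structure ALit where
  lit : Lit
  dec : Bool
deriving DecidableEq

/-- A state: `fail` or a record (ordered list of annotated literals). -/
inductive DpState where
  | fail : DpState
  | of : List ALit → DpState

/-- The literals of a record, in order. -/
def litsOf (M : List ALit) : List Lit := M.map ALit.lit

/-- The set of literals of a record. -/
def litSet (M : List ALit) : Set Lit := {l | l ∈ litsOf M}

/-- A record is inconsistent if it contains an atom together with its negation. -/
def inconsistentRec (M : List ALit) : Prop :=
  ∃ a : Atom, Lit.pos a ∈ litsOf M ∧ Lit.neg a ∈ litsOf M

/-- A record contains no decision literals. -/
def noDecision (M : List ALit) : Prop := ∀ x ∈ M, x.dec = false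

/-- `l` is unassigned by the record `M`. -/
def unassignedBy (M : List ALit) (l : Lit) : Prop := l ∉ litsOf M ∧ l.compl ∉ litsOf M

/-- A record relative to the set `A` of atoms: an ordered set of literals over `A`. -/
def isRecord (A : Set Atom) (M : List ALit) : Prop :=
  (litsOf M).Nodup ∧ ∀ l ∈ litsOf M, l.atom ∈ A

/-- A state relative to the set `A` of atoms. -/
def isState (A : Set Atom) : DpState → Prop
  | .fail => True
  | .of M => isRecord A M

/-- The transition rules of the DPLL graph of the clause set `G`. -/
inductive DPStep (G : CNF) : DpState → DpState → Prop
  | unitPropagate (M : List ALit) (C : Clause) (l : Lit) :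
      C ∈ G → l ∈ C → (∀ k ∈ C, k ≠ l → k.compl ∈ litsOf M) →
      DPStep G (.of M) (.of (M ++ [⟨l, false⟩]))
  | decide (M : List ALit) (l : Lit) :
      unassignedBy M l → DPStep G (.of M) (.of (M ++ [⟨l, true⟩]))
  | fail (M : List ALit) :
      inconsistentRec M → noDecision M → DPStep G (.of M) .fail
  | backtrack (Pre Q : List ALit) (l : Lit) :
      inconsistentRec (Pre ++ ⟨l, true⟩ :: Q) → noDecision Q →
      DPStep G (.of (Pre ++ ⟨l, true⟩ :: Q)) (.of (Pre ++ [⟨l.compl, false⟩]))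

/-- The edges of the graph `DP_G` over states relative to `A`. -/
def dpEdge (G : CNF) (A : Set Atom) (s s' : DpState) : Prop :=
  isState A s ∧ isState A s' ∧ DPStep G s s'

/-- The transition rules of the graph `SM(ASP)_{F,Π}`: the DPLL rules for `F ∪ Π^cl`
together with the rule Unfounded (w.r.t. `Π^o`). -/
inductive SMStep (F : CNF) (P : Program) : DpState → DpState → Prop
  | dpll {s s' : DpState} : DPStep (F ∪ progCl P) s s' → SMStep F P s s'
  | unfounded (M : List ALit) (U : Set Atom) (a : Atom) :
      consistentS (litSet M) → unfoundedOn U (litSet M) (progO F P) → a ∈ U →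
      SMStep F P (.of M) (.of (M ++ [⟨Lit.neg a, false⟩]))

/-- The edges of the graph `SM(ASP)_{F,Π}`. -/
def smEdge (F : CNF) (P : Program) (s s' : DpState) : Prop :=
  isState (atomsTh F P) s ∧ isState (atomsTh F P) s' ∧ SMStep F P s s'

/-- `F,Π^o ⊨ C`: every model of the SM(ASP) theory `[F,Π]` satisfies the clause `C`. -/
def entailsClause (F : CNF) (P : Program) (C : Clause) : Prop :=
  ∀ M : Set Lit, smModel F P M → ∃ l ∈ C, l ∈ M

/-- Augmented states: `fail`, or a record together with a set of learned clauses. -/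
inductive ANode where
  | fail : ANode
  | st : List ALit → CNF → ANode

/-- A valid augmented state relative to `F` and `Π`. -/
def isANode (F : CNF) (P : Program) : ANode → Prop
  | .fail => True
  | .st M Γ => isRecord (atomsTh F P) M ∧
      ∀ C ∈ Γ, (∀ l ∈ C, l.atom ∈ atomsTh F P) ∧ entailsClause F P C

/-- The basic transition rules of the graph `SM(ASP)L_{F,Π}`. -/
inductive SMLBasic (F : CNF) (P : Program) : ANode → ANode → Prop
  | unitPropagateLearn (M : List ALit) (Γ : CNF) (C : Clause) (l : Lit) :
      C ∈ F ∪ progCl P ∪ Γ → l ∈ C → (∀ k ∈ C, k ≠ l → k.compl ∈ litsOf M) →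
      SMLBasic F P (.st M Γ) (.st (M ++ [⟨l, false⟩]) Γ)
  | decide (M : List ALit) (Γ : CNF) (l : Lit) :
      unassignedBy M l → SMLBasic F P (.st M Γ) (.st (M ++ [⟨l, true⟩]) Γ)
  | fail (M : List ALit) (Γ : CNF) :
      inconsistentRec M → noDecision M → SMLBasic F P (.st M Γ) .fail
  | backjump (Pre Q : List ALit) (l l' : Lit) (Γ : CNF) :
      inconsistentRec (Pre ++ ⟨l, true⟩ :: Q) →
      entailsClause F P (insert l' (compls (litSet Pre))) →
      SMLBasic F P (.st (Pre ++ ⟨l, true⟩ :: Q) Γ) (.st (Pre ++ [⟨l', false⟩]) Γ)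
  | unfounded (M : List ALit) (Γ : CNF) (U : Set Atom) (a : Atom) :
      consistentS (litSet M) → unfoundedOn U (litSet M) (progO F P) → a ∈ U →
      SMLBasic F P (.st M Γ) (.st (M ++ [⟨Lit.neg a, false⟩]) Γ)

/-- The transition rule Learn of `SM(ASP)L_{F,Π}`. -/
def learnStep (F : CNF) (P : Program) (n n' : ANode) : Prop :=
  ∃ (M : List ALit) (Γ : CNF) (C : Clause),
    n = ANode.st M Γ ∧ n' = ANode.st M (insert C Γ) ∧
    (∀ l ∈ C, l.atom ∈ atomsCNF F) ∧ entailsClause F P C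

/-- The transition rules of `SM(ASP)L_{F,Π}`: the basic rules and Learn. -/
def SMLStep (F : CNF) (P : Program) (n n' : ANode) : Prop :=
  SMLBasic F P n n' ∨ learnStep F P n n'

/-- The edges of the graph `SM(ASP)L_{F,Π}`. -/
def smlEdge (F : CNF) (P : Program) (n n' : ANode) : Prop :=
  isANode F P n ∧ isANode F P n' ∧ SMLStep F P n n'

/-- The edges of `SM(ASP)L_{F,Π}` justified by a basic transition rule. -/
def smlBasicEdge (F : CNF) (P : Program) (n n' : ANode) : Prop :=
  isANode F P n ∧ isANode F P n' ∧ SMLBasic F P n n'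

/-- `F` is a `Π`-safe set of clauses. -/
def piSafe (F : CNF) (P : Program) : Prop :=
  (∀ a ∈ atomsProg P \ headSet P, ∀ X : Set Atom, cnfTrue X F → a ∉ X) ∧
  ∀ X : Set Atom, isAnswerSet P X →
    ∃ M : Set Lit, consistentS M ∧ completeOver M (atomsTh F P) ∧ modelCNF M F ∧
      X = posPart M ∩ headSet P

/-- Atoms that are not heads cannot be derived, so answer sets consist of heads. -/
theorem isAnswerSet.subset_headSet {P : Program} {X : Set Atom} (h : isAnswerSet P X) :
    X ⊆ headSet P := by
  rw [h.1]
  exact Set.sInter_subset_of_mem fun r hr _ _ _ ha => ⟨r, hr, ha⟩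

/-- When every atom of `X` is a head, no input facts are added. -/
theorem inputAnswerSet_iff_isAnswerSet {P : Program} {X : Set Atom} (h : X ⊆ headSet P) :
    inputAnswerSet P X ↔ isAnswerSet P X := by
  rw [inputAnswerSet, Set.sdiff_eq_empty.mpr h, Set.image_empty, Set.union_empty]

/-- For a logic program `Π` and a set `X` of atoms:
`X ⊆ Head(Π)` and `X` is an input answer set of `Π` iff `X` is an answer set of `Π`. -/
theorem input_answer_set_subset_head (P : Program) (hP : IsProgram P) (X : Set Atom) :
    (X ⊆ headSet P ∧ inputAnswerSet P X) ↔ isAnswerSet P X := by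
  exact ⟨fun h => (inputAnswerSet_iff_isAnswerSet h.1).mp h.2,
    fun h => ⟨h.subset_headSet, (inputAnswerSet_iff_isAnswerSet h.subset_headSet).mpr h⟩⟩
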